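/- Let f₀, f₁ be smooth vector fields on ℝⁿ. For all integers i, l with 0 ≤ l ≤ i, the following identity of vector fields holds: [f₁, ad^i_{f₀}(f₁)] = Σ_{j=0}^{l−1} (−1)ʲ [f₀, [ad^j_{f₀}(f₁), ad^{i−j−1}_{f₀}(f₁)]] + (−1)ˡ [ad^l_{f₀}(f₁), ad^{i−l}_{f₀}(f₁)]. -/

import Mathlib

noncomputable section

/-- `ℝⁿ` with its Euclidean structure. -/
abbrev Euc (n : ℕ) := EuclideanSpace ℝ (Fin n)

/-- The Lie bracket of vector fields: `[X,Y](x) := Y'(x)·X(x) − X'(x)·Y(x)`. -/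
def lieB {n : ℕ} (X Y : Euc n → Euc n) : Euc n → Euc n :=
  fun x => fderiv ℝ Y x (X x) - fderiv ℝ X x (Y x)

/-- Iterated adjoint: `ad⁰_X(Y) := Y`, `ad^{k+1}_X(Y) := [X, ad^k_X(Y)]`. -/
def adk {n : ℕ} (X Y : Euc n → Euc n) : ℕ → (Euc n → Euc n)
  | 0 => Y
  | k+1 => lieB X (adk X Y k)

theorem contDiff_lieB {n : ℕ} {X Y : Euc n → Euc n}
    (hX : ContDiff ℝ (⊤ : ℕ∞) X) (hY : ContDiff ℝ (⊤ : ℕ∞) Y) :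
    ContDiff ℝ (⊤ : ℕ∞) (lieB X Y) :=
  ContDiff.lieBracket_vectorField (𝕜 := ℝ) hX hY (by simp)

theorem contDiff_adk {n : ℕ} {X Y : Euc n → Euc n}
    (hX : ContDiff ℝ (⊤ : ℕ∞) X) (hY : ContDiff ℝ (⊤ : ℕ∞) Y) (k : ℕ) :
    ContDiff ℝ (⊤ : ℕ∞) (adk X Y k) := by
  induction k with
  | zero => exact hY
  | succ k ih => exact contDiff_lieB hX ih

theorem lieB_leibniz {n : ℕ} {X Y Z : Euc n → Euc n}
    (hX : ContDiff ℝ (⊤ : ℕ∞) X) (hY : ContDiff ℝ (⊤ : ℕ∞) Y)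
    (hZ : ContDiff ℝ (⊤ : ℕ∞) Z) (x : Euc n) :
    lieB X (lieB Y Z) x = lieB (lieB X Y) Z x + lieB Y (lieB X Z) x :=
  VectorField.leibniz_identity_lieBracket (𝕜 := ℝ) (n := (⊤ : ℕ∞))
    (by simpa using WithTop.coe_le_coe.2 (le_top : (2 : ℕ∞) ≤ ⊤))
    hX.contDiffAt hY.contDiffAt hZ.contDiffAt

/-- For smooth vector fields `f₀, f₁` on `ℝⁿ` and `0 ≤ l ≤ i`:
`[f₁, ad^i_{f₀}(f₁)] = Σ_{j=0}^{l−1} (−1)ʲ [f₀, [ad^j_{f₀}(f₁), ad^{i−j−1}_{f₀}(f₁)]]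
 + (−1)ˡ [ad^l_{f₀}(f₁), ad^{i−l}_{f₀}(f₁)]`. -/
theorem statement12
    (n : ℕ) (f₀ f₁ : Euc n → Euc n)
    (hf₀ : ContDiff ℝ (⊤ : ℕ∞) f₀) (hf₁ : ContDiff ℝ (⊤ : ℕ∞) f₁)
    (i l : ℕ) (hl : l ≤ i) :
    ∀ x : Euc n,
      lieB f₁ (adk f₀ f₁ i) x =
        (∑ j ∈ Finset.range l,
          ((-1 : ℝ) ^ j) •
            lieB f₀ (lieB (adk f₀ f₁ j) (adk f₀ f₁ (i - j - 1))) x)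
        + ((-1 : ℝ) ^ l) • lieB (adk f₀ f₁ l) (adk f₀ f₁ (i - l)) x := by
  intro x
  induction l with
  | zero => simp [adk]
  | succ l ih =>
    obtain ⟨m, rfl⟩ := Nat.exists_eq_add_of_le hl
    have hl₁ : l + 1 + m - l - 1 = m := by lia
    have hl₂ : l + 1 + m - l = m + 1 := by lia
    have hl₃ : l + 1 + m - (l + 1) = m := by lia
    rw [ih (by lia), Finset.sum_range_succ, hl₁, hl₂, hl₃,
      lieB_leibniz hf₀ (contDiff_adk hf₀ hf₁ l) (contDiff_adk hf₀ hf₁ m) x]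
    simp only [adk, pow_succ]
    module
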